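/- Let η₀, η₁, η₂ ∈ ℂ³ be nonzero vectors satisfying ⟨η₀, η₁⟩ = 0, ⟨η₁, η₂⟩ = 0, and ⟨η₂, η₀⟩ ≠ 0 (exactly two orthogonal pairs). Then there exists a 3×3 unitary matrix U over ℂ such that the transformed vectors χᵢ = Σ_{j=0}^{2} U_{ij} • η_j are mutually non-orthogonal: ⟨χᵢ, χ_j⟩ ≠ 0 for all i ≠ j. -/

import Mathlib

open scoped InnerProductSpace

theorem aux_symm (χ : Fin 3 → EuclideanSpace ℂ (Fin 3))
    (h1 : ⟪χ 0, χ 1⟫_ℂ ≠ 0) (h2 : ⟪χ 0, χ 2⟫_ℂ ≠ 0) (h3 : ⟪χ 1, χ 2⟫_ℂ ≠ 0) :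
    ∀ i j : Fin 3, i ≠ j → ⟪χ i, χ j⟫_ℂ ≠ 0 := by
  have k1 : ⟪χ 1, χ 0⟫_ℂ ≠ 0 := fun h => h1 (inner_eq_zero_symm.1 h)
  have k2 : ⟪χ 2, χ 0⟫_ℂ ≠ 0 := fun h => h2 (inner_eq_zero_symm.1 h)
  have k3 : ⟪χ 2, χ 1⟫_ℂ ≠ 0 := fun h => h3 (inner_eq_zero_symm.1 h)
  intro i j hij
  fin_cases i <;> fin_cases j <;> first | exact absurd rfl hij | assumption

theorem aux_ne (z : ℂ) (hz : z ≠ 0) (p q : ℝ) (hpq : p ^ 2 ≠ q ^ 2) :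
    (p : ℂ) * z + q * (starRingEnd ℂ) z ≠ 0 := by
  intro h
  have h1 : (p : ℂ) * z = -(q * (starRingEnd ℂ) z) := by linear_combination h
  have h2 := congrArg Complex.normSq h1
  simp only [Complex.normSq_neg, Complex.normSq_mul, Complex.normSq_conj,
    Complex.normSq_ofReal] at h2
  have h3 : Complex.normSq z ≠ 0 := by simpa using hz
  apply hpq
  have := mul_right_cancel₀ h3 h2
  nlinarith

/-- **Theorem 3.**
Three nonzero vectors with exactly two orthogonal pairs
(`⟪η 0, η 1⟫ = 0`, `⟪η 1, η 2⟫ = 0`, `⟪η 2, η 0⟫ ≠ 0`) are local-unitarily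
equivalent to three mutually non-orthogonal vectors: there is a unitary `U`
such that the transformed vectors `χ i = ∑ j, U i j • η j` satisfy
`⟪χ i, χ j⟫ ≠ 0` for all `i ≠ j`. -/
theorem two_orthogonal_pairs_LU_equivalent_to_mutually_nonorthogonal
    (η : Fin 3 → EuclideanSpace ℂ (Fin 3))
    (hne : ∀ i, η i ≠ 0)
    (h01 : ⟪η 0, η 1⟫_ℂ = 0) (h12 : ⟪η 1, η 2⟫_ℂ = 0) (h20 : ⟪η 2, η 0⟫_ℂ ≠ 0) :
    ∃ U ∈ Matrix.unitaryGroup (Fin 3) ℂ,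
      ∀ i j : Fin 3, i ≠ j →
        ⟪∑ k, U i k • η k, ∑ k, U j k • η k⟫_ℂ ≠ 0 := by
  have h10 : ⟪η 1, η 0⟫_ℂ = 0 := inner_eq_zero_symm.1 h01
  have h21 : ⟪η 2, η 1⟫_ℂ = 0 := inner_eq_zero_symm.1 h12
  have h02 : ⟪η 0, η 2⟫_ℂ ≠ 0 := fun h => h20 (inner_eq_zero_symm.1 h)
  have hc : ⟪η 0, η 2⟫_ℂ = (starRingEnd ℂ) ⟪η 2, η 0⟫_ℂ := (inner_conj_symm _ _).symm
  by_cases hab : ⟪η 0, η 0⟫_ℂ = ⟪η 1, η 1⟫_ℂ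
  · by_cases hbc : ⟪η 1, η 1⟫_ℂ = ⟪η 2, η 2⟫_ℂ
    · refine ⟨!![1/3, 2/3, 2/3; 2/3, 1/3, -2/3; 2/3, -2/3, 1/3], ?_, ?_⟩
      · rw [Matrix.mem_unitaryGroup_iff]
        ext i j
        fin_cases i <;> fin_cases j <;>
          simp [Matrix.mul_apply, Fin.sum_univ_three, Matrix.star_apply, map_ofNat] <;> norm_num
      · refine aux_symm _ ?_ ?_ ?_
        · have := aux_ne _ h20 (4/9) (-2/9) (by norm_num)
          intro h
          apply this
          simp [-inner_self_eq_norm_sq_to_K, -inner_conj_symm, map_ofNat, Fin.sum_univ_three, inner_add_left, inner_add_right, inner_smul_left,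
            inner_smul_right, h01, h10, h12, h21, hab, hbc, hc] at h
          push_cast
          linear_combination h
        · have := aux_ne _ h20 (4/9) (1/9) (by norm_num)
          intro h
          apply this
          simp [-inner_self_eq_norm_sq_to_K, -inner_conj_symm, map_ofNat, Fin.sum_univ_three, inner_add_left, inner_add_right, inner_smul_left,
            inner_smul_right, h01, h10, h12, h21, hab, hbc, hc] at h
          push_cast
          linear_combination h
        · have := aux_ne _ h20 (-4/9) (2/9) (by norm_num)
          intro h
          apply this
          simp [-inner_self_eq_norm_sq_to_K, -inner_conj_symm, map_ofNat, Fin.sum_univ_three, inner_add_left, inner_add_right, inner_smul_left,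
            inner_smul_right, h01, h10, h12, h21, hab, hbc, hc] at h
          push_cast
          linear_combination h
    · refine ⟨!![1, 0, 0; 0, 3/5, 4/5; 0, -4/5, 3/5], ?_, ?_⟩
      · rw [Matrix.mem_unitaryGroup_iff]
        ext i j
        fin_cases i <;> fin_cases j <;>
          simp [Matrix.mul_apply, Fin.sum_univ_three, Matrix.star_apply, map_ofNat] <;> norm_num
      · refine aux_symm _ ?_ ?_ ?_ <;> intro h <;>
          simp [-inner_self_eq_norm_sq_to_K, -inner_conj_symm, map_ofNat, Fin.sum_univ_three, inner_add_left, inner_add_right,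
            inner_smul_left, inner_smul_right, h01, h10, h12, h21, h02] at h
        exact hbc (by linear_combination (-25/12) * h)
  · refine ⟨!![3/5, 4/5, 0; -4/5, 3/5, 0; 0, 0, 1], ?_, ?_⟩
    · rw [Matrix.mem_unitaryGroup_iff]
      ext i j
      fin_cases i <;> fin_cases j <;>
        simp [Matrix.mul_apply, Fin.sum_univ_three, Matrix.star_apply, map_ofNat] <;> norm_num
    · refine aux_symm _ ?_ ?_ ?_ <;> intro h <;>
        simp [-inner_self_eq_norm_sq_to_K, -inner_conj_symm, map_ofNat, Fin.sum_univ_three, inner_add_left, inner_add_right,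
          inner_smul_left, inner_smul_right, h01, h10, h12, h21, h02] at h
      exact hab (by linear_combination (-25/12) * h)
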